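/- arXiv:1706.01418 — 2 statements merged into one kernel-verified Lean document; each statement's English description precedes it below -/
import Mathlib

section
/- For any process 𝕏 the following are equivalent: (i) 𝕏 satisfies Condition 1; (ii) 𝕏 admits strong universal inductive learning; (iii) 𝕏 admits strong universal self-adaptive learning. Equivalently, SUIL = SUAL = C1. -/
open MeasureTheory Filter Topology

/-- The limsup of empirical averages of `g : X → ℝ` along the sequence `x`:
`μ̂_x(g) = limsup_{n→∞} (1/n) ∑_{t=1}^n g(x_t)`. -/
noncomputable def muHat {X : Type*} (x : ℕ → X) (g : X → ℝ) : ℝ :=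
  Filter.limsup (fun n : ℕ => (∑ t ∈ Finset.range n, g (x t)) / (n : ℝ)) Filter.atTop

/-- The limsup empirical frequency of the set `A` along the sequence `x`:
`μ̂_x(A) = μ̂_x(1_A)`. -/
noncomputable def muHatSet {X : Type*} (x : ℕ → X) (A : Set X) : ℝ :=
  muHat x (A.indicator fun _ => (1 : ℝ))

/-- Condition 1: for every monotone sequence `{A_k}` of measurable sets with `A_k ↓ ∅`,
`lim_{k→∞} E[μ̂_𝕏(A_k)] = 0`.  Here the process `𝕏` is represented by its law `μ` on the
path space `ℕ → X`, the coordinates being the random variables `X_t`. -/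
def Condition1 {X : Type*} [MeasurableSpace X] (μ : Measure (ℕ → X)) : Prop :=
  ∀ A : ℕ → Set X, (∀ k, MeasurableSet (A k)) → Antitone A → (⋂ k, A k) = ∅ →
    Tendsto (fun k => ∫ x, muHatSet x (A k) ∂μ) atTop (𝓝 0)

/-- An inductive learning rule: a sequence of measurable functions
`f_n : X^n × Y^n × X → Y`. -/
def IsInductiveRule {X Y : Type*} [MeasurableSpace X] [MeasurableSpace Y]
    (f : ∀ n : ℕ, (Fin n → X) → (Fin n → Y) → X → Y) : Prop :=
  ∀ n : ℕ, Measurable fun p : (Fin n → X) × (Fin n → Y) × X => f n p.1 p.2.1 p.2.2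

/-- The long-run average loss `L̂_𝕏(f_n, f*; n)` of an inductive learning rule along the
path `x` (0-indexed, so `x 0, x 1, …` are `X_1, X_2, …`):
`limsup_{t→∞} (1/t) ∑_{m=n+1}^{n+t} ℓ(f_n(X_{1:n}, f*(X_{1:n}), X_m), f*(X_m))`. -/
noncomputable def indLoss {X Y : Type*} [PseudoMetricSpace Y]
    (f : ∀ n : ℕ, (Fin n → X) → (Fin n → Y) → X → Y)
    (fstar : X → Y) (n : ℕ) (x : ℕ → X) : ℝ :=
  Filter.limsup
    (fun t : ℕ =>
      (∑ s ∈ Finset.range t,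
          dist (f n (fun i => x i.1) (fun i => fstar (x i.1)) (x (n + s)))
            (fstar (x (n + s)))) / (t : ℝ))
    Filter.atTop

/-- Strong universal consistency of an inductive learning rule under the process with
law `μ`: for every measurable target `f*`, `L̂_𝕏(f_n, f*; n) → 0` almost surely. -/
def StronglyConsistentInd {X Y : Type*} [MeasurableSpace X] [MeasurableSpace Y]
    [PseudoMetricSpace Y] (μ : Measure (ℕ → X))
    (f : ∀ n : ℕ, (Fin n → X) → (Fin n → Y) → X → Y) : Prop :=
  ∀ fstar : X → Y, Measurable fstar →
    ∀ᵐ x ∂μ, Tendsto (fun n => indLoss f fstar n x) atTop (𝓝 0)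

/-- `SUIL`: the process with law `μ` admits strong universal inductive learning. -/
def SUIL {X : Type*} (Y : Type*) [MeasurableSpace X] [MeasurableSpace Y] [PseudoMetricSpace Y]
    (μ : Measure (ℕ → X)) : Prop :=
  ∃ f : ∀ n : ℕ, (Fin n → X) → (Fin n → Y) → X → Y,
    IsInductiveRule f ∧ StronglyConsistentInd μ f

/-- A self-adaptive learning rule: an array of measurable functions
`f_{n,m} : X^m × Y^n × X → Y` for `m ≥ n ≥ 0`. -/
def IsSelfAdaptiveRule {X Y : Type*} [MeasurableSpace X] [MeasurableSpace Y]
    (f : ∀ n m : ℕ, (Fin m → X) → (Fin n → Y) → X → Y) : Prop :=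
  ∀ n m : ℕ, n ≤ m →
    Measurable fun p : (Fin m → X) × (Fin n → Y) × X => f n m p.1 p.2.1 p.2.2

/-- The long-run average loss `L̂_𝕏(f_{n,·}, f*; n)` of a self-adaptive learning rule
along the path `x` (0-indexed):
`limsup_{t→∞} (1/(t+1)) ∑_{m=n}^{n+t} ℓ(f_{n,m}(X_{1:m}, f*(X_{1:n}), X_{m+1}), f*(X_{m+1}))`. -/
noncomputable def adaLoss {X Y : Type*} [PseudoMetricSpace Y]
    (f : ∀ n m : ℕ, (Fin m → X) → (Fin n → Y) → X → Y)
    (fstar : X → Y) (n : ℕ) (x : ℕ → X) : ℝ :=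
  Filter.limsup
    (fun t : ℕ =>
      (∑ s ∈ Finset.range (t + 1),
          dist (f n (n + s) (fun i => x i.1) (fun i => fstar (x i.1)) (x (n + s)))
            (fstar (x (n + s)))) / ((t : ℝ) + 1))
    Filter.atTop

/-- Strong universal consistency of a self-adaptive learning rule under the process with
law `μ`. -/
def StronglyConsistentAda {X Y : Type*} [MeasurableSpace X] [MeasurableSpace Y]
    [PseudoMetricSpace Y] (μ : Measure (ℕ → X))
    (f : ∀ n m : ℕ, (Fin m → X) → (Fin n → Y) → X → Y) : Prop :=
  ∀ fstar : X → Y, Measurable fstar →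
    ∀ᵐ x ∂μ, Tendsto (fun n => adaLoss f fstar n x) atTop (𝓝 0)

/-- `SUAL`: the process with law `μ` admits strong universal self-adaptive learning. -/
def SUAL {X : Type*} (Y : Type*) [MeasurableSpace X] [MeasurableSpace Y] [PseudoMetricSpace Y]
    (μ : Measure (ℕ → X)) : Prop :=
  ∃ f : ∀ n m : ℕ, (Fin m → X) → (Fin n → Y) → X → Y,
    IsSelfAdaptiveRule f ∧ StronglyConsistentAda μ f


/-! ### Sequence lemmas -/

noncomputable def av (a : ℕ → ℝ) (n : ℕ) : ℝ := (∑ t ∈ Finset.range n, a t) / (n : ℝ)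

noncomputable def Lav (a : ℕ → ℝ) : ℝ := Filter.limsup (av a) Filter.atTop

def InB (C : ℝ) (a : ℕ → ℝ) : Prop := ∀ t, 0 ≤ a t ∧ a t ≤ C

lemma av_nonneg {C : ℝ} {a : ℕ → ℝ} (h : InB C a) (n : ℕ) : 0 ≤ av a n :=
  div_nonneg (Finset.sum_nonneg fun t _ => (h t).1) (Nat.cast_nonneg n)

lemma InB.C_nonneg {C : ℝ} {a : ℕ → ℝ} (h : InB C a) : 0 ≤ C := (h 0).1.trans (h 0).2

lemma av_le {C : ℝ} {a : ℕ → ℝ} (h : InB C a) (n : ℕ) : av a n ≤ C := by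
  unfold av
  rcases Nat.eq_zero_or_pos n with rfl | hn
  · simpa using h.C_nonneg
  · have hn' : (0 : ℝ) < n := by exact_mod_cast hn
    rw [div_le_iff₀ hn']
    calc (∑ t ∈ Finset.range n, a t) ≤ ∑ t ∈ Finset.range n, C :=
          Finset.sum_le_sum fun t _ => (h t).2
      _ = C * n := by simp [mul_comm]

lemma bdd_le {C : ℝ} {u : ℕ → ℝ} (h : ∀ n, u n ≤ C) : IsBoundedUnder (· ≤ ·) atTop u :=
  isBoundedUnder_of ⟨C, h⟩

lemma bdd_ge {C : ℝ} {u : ℕ → ℝ} (h : ∀ n, C ≤ u n) : IsBoundedUnder (· ≥ ·) atTop u :=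
  isBoundedUnder_of ⟨C, h⟩

lemma cobdd_le {C : ℝ} {u : ℕ → ℝ} (h : ∀ n, C ≤ u n) : IsCoboundedUnder (· ≤ ·) atTop u :=
  (bdd_ge h).isCoboundedUnder_flip

lemma limsup_le_real {u : ℕ → ℝ} {c b : ℝ} (h0 : ∀ n, c ≤ u n) (h : ∀ᶠ n in atTop, u n ≤ b) :
    limsup u atTop ≤ b := limsup_le_of_le (cobdd_le h0) h

lemma limsup_ge_real {u : ℕ → ℝ} {C b : ℝ} (h0 : ∀ n, u n ≤ C) (h : ∃ᶠ n in atTop, b ≤ u n) :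
    b ≤ limsup u atTop := le_limsup_of_frequently_le h (bdd_le h0)

lemma ev_le_limsup {u : ℕ → ℝ} {C ε : ℝ} (h0 : ∀ n, u n ≤ C) (hε : 0 < ε) :
    ∀ᶠ n in atTop, u n ≤ limsup u atTop + ε := by
  filter_upwards [eventually_lt_of_limsup_lt (lt_add_of_pos_right (limsup u atTop) hε)
    (bdd_le h0)] with n hn using hn.le

lemma freq_ge_limsup {u : ℕ → ℝ} {c ε : ℝ} (h0 : ∀ n, c ≤ u n) (hε : 0 < ε) :
    ∃ᶠ n in atTop, limsup u atTop - ε ≤ u n := by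
  have := frequently_lt_of_lt_limsup (cobdd_le h0) (sub_lt_self (limsup u atTop) hε)
  exact this.mono fun n hn => hn.le

lemma limsup_le_limsup_of_sub {u v : ℕ → ℝ} {c C : ℝ} (hu : ∀ n, c ≤ u n) (hv : ∀ n, v n ≤ C)
    (h : ∀ ε > 0, ∀ᶠ n in atTop, u n ≤ v n + ε) : limsup u atTop ≤ limsup v atTop := by
  refine le_of_forall_pos_le_add fun ε hε => ?_
  refine limsup_le_real hu ?_
  filter_upwards [h (ε / 2) (by positivity), ev_le_limsup hv (half_pos hε)] with n h1 h2
  linarith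

lemma Lav_nonneg {C : ℝ} {a : ℕ → ℝ} (h : InB C a) : 0 ≤ Lav a :=
  limsup_ge_real (av_le h) (Frequently.of_forall (av_nonneg h))

lemma Lav_le {C : ℝ} {a : ℕ → ℝ} (h : InB C a) : Lav a ≤ C :=
  limsup_le_real (av_nonneg h) (Eventually.of_forall (av_le h))

lemma av_mono {a b : ℕ → ℝ} (h : ∀ t, a t ≤ b t) (n : ℕ) : av a n ≤ av b n :=
  div_le_div_of_nonneg_right (Finset.sum_le_sum fun t _ => h t) (Nat.cast_nonneg n)

lemma av_add (a b : ℕ → ℝ) (n : ℕ) : av (fun t => a t + b t) n = av a n + av b n := by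
  simp [av, Finset.sum_add_distrib, add_div]

lemma av_smul (c : ℝ) (a : ℕ → ℝ) (n : ℕ) : av (fun t => c * a t) n = c * av a n := by
  simp [av, ← Finset.mul_sum, mul_div_assoc]

lemma Lav_le_add {A B C : ℝ} {a b c : ℕ → ℝ} (ha : InB A a) (hb : InB B b) (hc : InB C c)
    (h : ∀ t, a t ≤ b t + c t) : Lav a ≤ Lav b + Lav c := by
  refine le_of_forall_pos_le_add fun ε hε => ?_
  refine limsup_le_real (av_nonneg ha) ?_
  filter_upwards [ev_le_limsup (av_le hb) (half_pos hε),
    ev_le_limsup (av_le hc) (half_pos hε)] with n h1 h2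
  have := av_mono h n
  rw [av_add] at this
  unfold Lav
  linarith

lemma Lav_mono {A B : ℝ} {a b : ℕ → ℝ} (ha : InB A a) (hb : InB B b)
    (h : ∀ t, a t ≤ b t) : Lav a ≤ Lav b := by
  refine limsup_le_limsup_of_sub (av_nonneg ha) (av_le hb) fun ε hε => ?_
  exact Eventually.of_forall fun n => (av_mono h n).trans (by linarith)

lemma Lav_const_mul {A c : ℝ} {a : ℕ → ℝ} (ha : InB A a) (hc : 0 ≤ c) :
    Lav (fun t => c * a t) ≤ c * Lav a := by
  refine le_of_forall_pos_le_add fun ε hε => ?_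
  have h1 : ∀ n, 0 ≤ av (fun t => c * a t) n := fun n => by
    rw [av_smul]; exact mul_nonneg hc (av_nonneg ha n)
  refine limsup_le_real h1 ?_
  have hd : 0 < ε / (c + 1) := by positivity
  filter_upwards [ev_le_limsup (av_le ha) hd] with n hn
  rw [av_smul]
  have h2 : c * (ε / (c + 1)) ≤ ε := by
    rw [mul_div_assoc', div_le_iff₀ (by positivity)]; nlinarith
  have := mul_le_mul_of_nonneg_left hn hc
  unfold Lav
  linarith

/-- shifted averages -/
lemma av_shift_sub {C : ℝ} {a : ℕ → ℝ} (ha : InB C a) (n t : ℕ) (ht : 0 < t) :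
    |av (fun s => a (n + s)) t - av a (n + t)| ≤ n * C / t := by
  have ht' : (0 : ℝ) < t := by exact_mod_cast ht
  have hn' : (0 : ℝ) ≤ n := Nat.cast_nonneg n
  have hC := ha.C_nonneg
  unfold av
  rw [Finset.sum_range_add]
  set H := ∑ x ∈ Finset.range n, a x
  set S := ∑ x ∈ Finset.range t, a (n + x)
  have hH0 : 0 ≤ H := Finset.sum_nonneg fun s _ => (ha s).1
  have hS0 : 0 ≤ S := Finset.sum_nonneg fun s _ => (ha _).1
  have hH : H ≤ n * C := by
    calc H ≤ ∑ x ∈ Finset.range n, C := Finset.sum_le_sum fun t _ => (ha t).2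
      _ = n * C := by simp
  have hS : S ≤ t * C := by
    calc S ≤ ∑ x ∈ Finset.range t, C := Finset.sum_le_sum fun t _ => (ha _).2
      _ = t * C := by simp
  push_cast
  have e : S / t - (H + S) / (n + t) = (n * S - t * H) / (t * (n + t)) := by
    field_simp; ring
  rw [e, abs_div, abs_of_pos (show (0 : ℝ) < t * (n + t) by positivity),
    div_le_div_iff₀ (by positivity) ht']
  have h1 : |(n : ℝ) * S - t * H| ≤ n * t * C := by
    rw [abs_le]; constructor
    · nlinarith [mul_le_mul_of_nonneg_left hH ht'.le, mul_nonneg hn' hS0]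
    · nlinarith [mul_le_mul_of_nonneg_left hS hn', mul_nonneg ht'.le hH0]
  have h2 : (n : ℝ) * t * C * t ≤ n * C * (t * (n + t)) := by
    have : 0 ≤ (n : ℝ) * C * (t * n) := by positivity
    nlinarith
  nlinarith [mul_le_mul_of_nonneg_right h1 ht'.le]

lemma Lav_shift {C : ℝ} {a : ℕ → ℝ} (ha : InB C a) (n : ℕ) :
    Lav (fun s => a (n + s)) = Lav a := by
  have hs : InB C (fun s => a (n + s)) := fun s => ha _
  have e : Lav a = limsup (fun t => av a (n + t)) atTop := by
    have := limsup_nat_add (av a) n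
    simp only [add_comm _ n] at this
    exact this.symm
  have key : ∀ ε > 0, ∀ᶠ t : ℕ in atTop, |av (fun s => a (n + s)) t - av a (n + t)| ≤ ε := by
    intro ε hε
    have : Tendsto (fun t : ℕ => n * C / (t : ℝ)) atTop (𝓝 0) :=
      tendsto_const_div_atTop_nhds_zero_nat _
    filter_upwards [this.eventually (ge_mem_nhds hε), eventually_gt_atTop 0] with t h1 h2
    exact (av_shift_sub ha n t h2).trans h1
  rw [e]
  apply le_antisymm
  · refine limsup_le_limsup_of_sub (av_nonneg hs) (fun t => av_le ha (n + t)) fun ε hε => ?_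
    filter_upwards [key ε hε] with t ht
    linarith [(abs_le.1 ht).2]
  · refine limsup_le_limsup_of_sub (fun t => av_nonneg ha (n + t)) (av_le hs) fun ε hε => ?_
    filter_upwards [key ε hε] with t ht
    linarith [(abs_le.1 ht).1]

/-- windowed maximum -/
noncomputable def Wm (a : ℕ → ℝ) (u n : ℕ) : ℝ :=
  (Finset.range (n + 1)).sup' Finset.nonempty_range_add_one
    (fun m => if u ≤ m then av a m else 0)

lemma Wm_le {a : ℕ → ℝ} {u n : ℕ} {c : ℝ} (hc : 0 ≤ c) (h : ∀ m, u ≤ m → av a m ≤ c) :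
    Wm a u n ≤ c := by
  refine Finset.sup'_le _ _ fun m _ => ?_
  split_ifs with hm
  · exact h m hm
  · exact hc

lemma le_Wm (a : ℕ → ℝ) {u n m : ℕ} (hu : u ≤ m) (hn : m ≤ n) : av a m ≤ Wm a u n := by
  have := Finset.le_sup' (fun m => if u ≤ m then av a m else 0)
    (Finset.mem_range.2 (Nat.lt_succ_of_le hn))
  simp only [hu, if_true] at this
  exact this

lemma Wm_mono (a : ℕ → ℝ) (u : ℕ) : Monotone (Wm a u) := by
  intro n n' h
  exact Finset.sup'_mono _ (Finset.range_subset_range.2 (by omega)) _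

lemma Wm_le_add {a b c : ℕ → ℝ} (h : ∀ t, a t ≤ b t + c t) (u n : ℕ) :
    Wm a u n ≤ Wm b u n + Wm c u n := by
  refine Finset.sup'_le _ _ fun m hm => ?_
  have h1 := Finset.le_sup' (fun m => if u ≤ m then av b m else 0) hm
  have h2 := Finset.le_sup' (fun m => if u ≤ m then av c m else 0) hm
  have h3 := av_mono h m
  rw [av_add] at h3
  refine le_trans ?_ (add_le_add h1 h2)
  split_ifs
  · exact h3
  · simp

lemma Wm_congr {a b : ℕ → ℝ} {u n : ℕ} (h : ∀ t < n, a t = b t) : Wm a u n = Wm b u n := by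
  unfold Wm
  refine Finset.sup'_congr _ rfl fun m hm => ?_
  have : av a m = av b m := by
    unfold av
    rw [Finset.sum_congr rfl fun t ht => h t ?_]
    have := Finset.mem_range.1 hm
    have := Finset.mem_range.1 ht
    omega
  rw [this]

lemma Wm_ge {C : ℝ} {a : ℕ → ℝ} (ha : InB C a) (u : ℕ) {ε : ℝ} (hε : 0 < ε) :
    ∃ n, Lav a - ε ≤ Wm a u n := by
  obtain ⟨m, h1, h2⟩ := ((freq_ge_limsup (av_nonneg ha) hε).and_eventually
    (eventually_ge_atTop u)).exists
  exact ⟨m, h1.trans (le_Wm a h2 le_rfl)⟩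

lemma measurable_av {Ω : Type*} [MeasurableSpace Ω] {a : Ω → ℕ → ℝ}
    (h : ∀ t, Measurable fun w => a w t) (n : ℕ) : Measurable fun w => av (a w) n := by
  unfold av
  exact (Finset.measurable_fun_sum _ fun t _ => h t).div_const _

lemma measurable_Lav {Ω : Type*} [MeasurableSpace Ω] {a : Ω → ℕ → ℝ}
    (h : ∀ t, Measurable fun w => a w t) : Measurable fun w => Lav (a w) :=
  Measurable.limsup fun n => measurable_av h n

lemma measurable_Wm {Ω : Type*} [MeasurableSpace Ω] {a : Ω → ℕ → ℝ}
    (h : ∀ t, Measurable fun w => a w t) (u n : ℕ) : Measurable fun w => Wm (a w) u n := by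
  unfold Wm
  refine Finset.measurable_range_sup'' fun m _ => ?_
  split_ifs
  · exact measurable_av h m
  · exact measurable_const

/-- reverse Fatou for bounded real functions -/
lemma limsup_integral_le_real {Ω : Type*} [MeasurableSpace Ω] (P : Measure Ω)
    [IsProbabilityMeasure P] {C : ℝ} {u : ℕ → Ω → ℝ} (hm : ∀ n, Measurable (u n))
    (h0 : ∀ n w, 0 ≤ u n w) (hC : ∀ n w, u n w ≤ C) :
    limsup (fun n => ∫ w, u n w ∂P) atTop ≤ ∫ w, limsup (fun n => u n w) atTop ∂P := by
  have hint : ∀ n, Integrable (u n) P := fun n =>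
    Integrable.of_bound (hm n).aestronglyMeasurable C (Eventually.of_forall fun w => by
      rw [Real.norm_eq_abs, abs_of_nonneg (h0 n w)]; exact hC n w)
  have hl0 : ∀ w, 0 ≤ limsup (fun n => u n w) atTop := fun w =>
    limsup_ge_real (fun n => hC n w) (Frequently.of_forall fun n => h0 n w)
  have hlC : ∀ w, limsup (fun n => u n w) atTop ≤ C := fun w =>
    limsup_le_real (fun n => h0 n w) (Eventually.of_forall fun n => hC n w)
  have hlm : Measurable fun w => limsup (fun n => u n w) atTop := Measurable.limsup hm
  have hlint : Integrable (fun w => limsup (fun n => u n w) atTop) P :=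
    Integrable.of_bound hlm.aestronglyMeasurable C (Eventually.of_forall fun w => by
      rw [Real.norm_eq_abs, abs_of_nonneg (hl0 w)]; exact hlC w)
  have hI0 : ∀ n, 0 ≤ ∫ w, u n w ∂P := fun n => integral_nonneg (h0 n)
  have hIC : ∀ n, ∫ w, u n w ∂P ≤ C := fun n => by
    calc ∫ w, u n w ∂P ≤ ∫ w, C ∂P := integral_mono (hint n) (integrable_const C) (hC n)
      _ = C := by simp
  have key := limsup_lintegral_le (μ := P) (f := fun n w => ENNReal.ofReal (u n w))
    (fun _ => ENNReal.ofReal C) (fun n => (hm n).ennreal_ofReal)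
    (fun n => Eventually.of_forall fun w => ENNReal.ofReal_le_ofReal (hC n w)) (by simp)
  have e1 : ∀ w, limsup (fun n => ENNReal.ofReal (u n w)) atTop
      = ENNReal.ofReal (limsup (fun n => u n w) atTop) := fun w =>
    (ENNReal.ofReal_limsup (cobdd_le fun n => h0 n w) (bdd_le fun n => hC n w)).symm
  have e2 : limsup (fun n => ∫⁻ w, ENNReal.ofReal (u n w) ∂P) atTop
      = ENNReal.ofReal (limsup (fun n => ∫ w, u n w ∂P) atTop) := by
    rw [ENNReal.ofReal_limsup (cobdd_le hI0) (bdd_le hIC)]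
    congr 1; funext n
    exact (ofReal_integral_eq_lintegral_ofReal (hint n) (Eventually.of_forall (h0 n))).symm
  simp only [e1] at key
  rw [e2, ← ofReal_integral_eq_lintegral_ofReal hlint (Eventually.of_forall hl0)] at key
  exact (ENNReal.ofReal_le_ofReal_iff (integral_nonneg hl0)).1 key

/-! ### The functional `Phi` -/

noncomputable def Phi {X : Type*} [MeasurableSpace X] (μ : Measure (ℕ → X)) (g : X → ℝ) : ℝ :=
  ∫ x, Lav (fun t => g (x t)) ∂μ

def GB {X : Type*} [MeasurableSpace X] (C : ℝ) (g : X → ℝ) : Prop :=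
  Measurable g ∧ ∀ z, 0 ≤ g z ∧ g z ≤ C

section PhiSec

set_option linter.unusedSectionVars false

variable {X : Type*} [MeasurableSpace X] {μ : Measure (ℕ → X)} [IsProbabilityMeasure μ]

lemma GB.inB {C : ℝ} {g : X → ℝ} (h : GB C g) (x : ℕ → X) : InB C (fun t => g (x t)) :=
  fun _ => h.2 _

lemma GB.meas {C : ℝ} {g : X → ℝ} (h : GB C g) :
    Measurable fun x : ℕ → X => Lav (fun t => g (x t)) :=
  measurable_Lav fun t => h.1.comp (measurable_pi_apply t)

lemma GB.int {C : ℝ} {g : X → ℝ} (h : GB C g) :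
    Integrable (fun x : ℕ → X => Lav (fun t => g (x t))) μ :=
  Integrable.of_bound h.meas.aestronglyMeasurable C (Eventually.of_forall fun x => by
    rw [Real.norm_eq_abs, abs_of_nonneg (Lav_nonneg (h.inB x))]; exact Lav_le (h.inB x))

lemma Phi_nonneg {C : ℝ} {g : X → ℝ} (h : GB C g) : 0 ≤ Phi μ g :=
  integral_nonneg fun x => Lav_nonneg (h.inB x)

lemma Phi_le {C : ℝ} {g : X → ℝ} (h : GB C g) : Phi μ g ≤ C := by
  calc Phi μ g ≤ ∫ x, C ∂μ :=
        integral_mono h.int (integrable_const C) fun x => Lav_le (h.inB x)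
    _ = C := by simp

lemma Phi_le_add {A B C : ℝ} {a b c : X → ℝ} (ha : GB A a) (hb : GB B b) (hc : GB C c)
    (h : ∀ z, a z ≤ b z + c z) : Phi μ a ≤ Phi μ b + Phi μ c := by
  unfold Phi
  rw [← integral_add hb.int hc.int]
  exact integral_mono ha.int (hb.int.add hc.int) fun x =>
    Lav_le_add (ha.inB x) (hb.inB x) (hc.inB x) fun t => h _

lemma Phi_const_mul {A c : ℝ} {a : X → ℝ} (ha : GB A a) (hc : 0 ≤ c) :
    Phi μ (fun z => c * a z) ≤ c * Phi μ a := by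
  unfold Phi
  rw [← integral_const_mul]
  have : GB (c * A) (fun z => c * a z) :=
    ⟨ha.1.const_mul c, fun z => ⟨mul_nonneg hc (ha.2 z).1,
      mul_le_mul_of_nonneg_left (ha.2 z).2 hc⟩⟩
  exact integral_mono this.int (ha.int.const_mul c) fun x => Lav_const_mul (ha.inB x) hc

lemma GB_ind {S : Set X} (hS : MeasurableSet S) : GB 1 (S.indicator fun _ => (1 : ℝ)) := by
  refine ⟨measurable_const.indicator hS, fun z => ?_⟩
  by_cases hz : z ∈ S <;> simp [hz]

lemma PhiSet_le_add {S T U : Set X} (hS : MeasurableSet S) (hT : MeasurableSet T)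
    (hU : MeasurableSet U) (h : S ⊆ T ∪ U) :
    Phi μ (S.indicator fun _ => (1 : ℝ)) ≤
      Phi μ (T.indicator fun _ => (1 : ℝ)) + Phi μ (U.indicator fun _ => (1 : ℝ)) := by
  refine Phi_le_add (GB_ind hS) (GB_ind hT) (GB_ind hU) fun z => ?_
  by_cases hz : z ∈ S
  · rcases h hz with h1 | h1
    · by_cases h2 : z ∈ U <;> simp [hz, h1, h2]
    · by_cases h2 : z ∈ T <;> simp [hz, h1, h2]
  · rw [Set.indicator_of_notMem hz]
    exact add_nonneg ((GB_ind hT).2 z).1 ((GB_ind hU).2 z).1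

lemma PhiSet_empty : Phi μ ((∅ : Set X).indicator fun _ => (1 : ℝ)) = 0 := by
  have h : GB (X := X) 0 ((∅ : Set X).indicator fun _ => (1 : ℝ)) := by
    refine ⟨measurable_const.indicator .empty, fun z => by simp⟩
  exact le_antisymm (Phi_le h) (Phi_nonneg h)

lemma Condition1.exists_le (h1 : Condition1 μ) {A : ℕ → Set X} (hm : ∀ k, MeasurableSet (A k))
    (ha : Antitone A) (he : (⋂ k, A k) = ∅) {ε : ℝ} (hε : 0 < ε) :
    ∃ k, Phi μ ((A k).indicator fun _ => (1 : ℝ)) ≤ ε :=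
  ((h1 A hm ha he).eventually (ge_mem_nhds hε)).exists

lemma approx_set (h1 : Condition1 μ) {b : Set (Set X)}
    (hb : ‹MeasurableSpace X› = MeasurableSpace.generateFrom b) (B : Set X)
    (hB : MeasurableSet B) : ∀ ε > 0, ∃ A ∈ generateSetAlgebra b, MeasurableSet A ∧
      Phi μ ((symmDiff A B).indicator fun _ => (1 : ℝ)) ≤ ε := by
  have halg : ∀ A ∈ generateSetAlgebra b, MeasurableSet A := by
    intro A hA
    rw [hb, ← generateFrom_generateSetAlgebra_eq]
    exact MeasurableSpace.measurableSet_generateFrom hA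
  suffices h : ∀ B, MeasurableSet[MeasurableSpace.generateFrom b] B →
      ∀ ε > 0, ∃ A ∈ generateSetAlgebra b,
        Phi μ ((symmDiff A B).indicator fun _ => (1 : ℝ)) ≤ ε by
    intro ε hε
    obtain ⟨A, hA, h⟩ := h B (hb ▸ hB) ε hε
    exact ⟨A, hA, halg A hA, h⟩
  intro B hB
  induction B, hB using MeasurableSpace.generateFrom_induction with
  | hC t ht _ =>
    intro ε hε
    refine ⟨t, self_subset_generateSetAlgebra ht, ?_⟩
    rw [symmDiff_self, Set.bot_eq_empty, PhiSet_empty]; exact hε.le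
  | empty =>
    intro ε hε
    refine ⟨∅, .empty, ?_⟩
    rw [symmDiff_self, Set.bot_eq_empty, PhiSet_empty]; exact hε.le
  | compl t ht ih =>
    intro ε hε
    obtain ⟨A, hA, h⟩ := ih ε hε
    refine ⟨Aᶜ, .compl _ hA, ?_⟩
    rwa [compl_symmDiff_compl]
  | iUnion s hs ih =>
    have hs' : ∀ n, MeasurableSet (s n) := fun n => by rw [hb]; exact hs n
    have hU : ∀ k, MeasurableSet (⋃ i < k, s i) := fun k =>
      MeasurableSet.iUnion fun i => MeasurableSet.iUnion fun _ => hs' i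
    have key : ∀ k, ∀ ε > 0, ∃ A ∈ generateSetAlgebra b,
        Phi μ ((symmDiff A (⋃ i < k, s i)).indicator fun _ => (1 : ℝ)) ≤ ε := by
      intro k
      induction k with
      | zero =>
        intro ε hε
        refine ⟨∅, .empty, ?_⟩
        have : (⋃ i < 0, s i) = ∅ := by simp
        rw [this, symmDiff_self, Set.bot_eq_empty, PhiSet_empty]; exact hε.le
      | succ k ihk =>
        intro ε hε
        obtain ⟨A, hA, h⟩ := ihk (ε / 2) (half_pos hε)
        obtain ⟨A', hA', h'⟩ := ih k (ε / 2) (half_pos hε)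
        refine ⟨A ∪ A', .union _ _ hA hA', ?_⟩
        rw [Set.biUnion_lt_succ]
        refine (PhiSet_le_add (((halg A hA).union (halg A' hA')).symmDiff ((hU k).union (hs' k)))
          ((halg A hA).symmDiff (hU k)) ((halg A' hA').symmDiff (hs' k)) ?_).trans
            (by linarith)
        intro z
        simp only [Set.mem_symmDiff, Set.mem_union]
        tauto
    intro ε hε
    have hD : ∀ k, MeasurableSet ((⋃ i, s i) \ ⋃ i < k, s i) := fun k =>
      (MeasurableSet.iUnion hs').diff (hU k)
    obtain ⟨k, hk⟩ := h1.exists_le hD (fun k l hkl => Set.sdiff_subset_sdiff_right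
        (Set.biUnion_subset_biUnion_left fun i (hi : i < k) => lt_of_lt_of_le hi hkl)) (by
        ext z
        simp only [Set.mem_iInter, Set.mem_sdiff, Set.mem_iUnion, Set.mem_empty_iff_false, iff_false]
        intro h
        obtain ⟨i, hi⟩ := (h 0).1
        exact (h (i + 1)).2 ⟨i, by omega, hi⟩) (half_pos hε)
    obtain ⟨A, hA, h⟩ := key k (ε / 2) (half_pos hε)
    refine ⟨A, hA, ?_⟩
    refine (PhiSet_le_add ((halg A hA).symmDiff (MeasurableSet.iUnion hs'))
      ((halg A hA).symmDiff (hU k)) (hD k) ?_).trans (by linarith)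
    intro z
    have : z ∈ (⋃ i < k, s i) → z ∈ ⋃ i, s i := fun h => by
      simp only [Set.mem_iUnion] at h ⊢
      obtain ⟨i, _, h⟩ := h
      exact ⟨i, h⟩
    simp only [Set.mem_symmDiff, Set.mem_union, Set.mem_sdiff]
    tauto

end PhiSec

open Classical in
/-- Simple functions coded by lists. -/
noncomputable def codeFun {X Y : Type*} (A : ℕ → Set X) (y : ℕ → Y) : List (ℕ × ℕ) → X → Y
  | [] => fun _ => y 0
  | p :: L => fun z => if z ∈ A p.1 then y p.2 else codeFun A y L z

lemma measurable_codeFun {X Y : Type*} [MeasurableSpace X] [MeasurableSpace Y] {A : ℕ → Set X}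
    (hA : ∀ n, MeasurableSet (A n)) (y : ℕ → Y) (L : List (ℕ × ℕ)) :
    Measurable (codeFun A y L) := by
  induction L with
  | nil => exact measurable_const
  | cons p L ih => exact Measurable.ite (hA p.1) measurable_const ih

/-- Under Condition 1 there is a countable dense family of measurable functions. -/
lemma exists_dense_family {X Y : Type*} [MeasurableSpace X]
    [MeasurableSpace.CountablyGenerated X]
    [MetricSpace Y] [TopologicalSpace.SeparableSpace Y] [Nonempty Y]
    [MeasurableSpace Y] [BorelSpace Y] {C : ℝ} (hC : ∀ y₁ y₂ : Y, dist y₁ y₂ ≤ C)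
    {μ : Measure (ℕ → X)} [IsProbabilityMeasure μ] (h1 : Condition1 μ) :
    ∃ F : ℕ → X → Y, (∀ j, Measurable (F j)) ∧ ∀ g : X → Y, Measurable g → ∀ ε > 0,
      ∃ j, Phi μ (fun z => dist (F j z) (g z)) ≤ ε := by
  have : SecondCountableTopology Y := UniformSpace.secondCountable_of_separable Y
  obtain ⟨b, hbc, hb⟩ := MeasurableSpace.CountablyGenerated.isCountablyGenerated (α := X)
  have hac := countable_generateSetAlgebra hbc
  obtain ⟨A, hA⟩ := hac.exists_eq_range ⟨∅, generateSetAlgebra.empty⟩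
  have hAm : ∀ n, MeasurableSet (A n) := by
    intro n
    rw [hb, ← generateFrom_generateSetAlgebra_eq]
    exact MeasurableSpace.measurableSet_generateFrom (hA ▸ Set.mem_range_self n)
  let y : ℕ → Y := TopologicalSpace.denseSeq Y
  have hC0 : 0 ≤ C := dist_nonneg.trans (hC (y 0) (y 0))
  have hGB : ∀ f g : X → Y, Measurable f → Measurable g → GB C (fun z => dist (f z) (g z)) :=
    fun f g hf hg => ⟨hf.dist hg, fun z => ⟨dist_nonneg, hC _ _⟩⟩
  have hcm := measurable_codeFun (Y := Y) hAm y
  refine ⟨fun j => codeFun A y (Denumerable.ofNat (List (ℕ × ℕ)) j), fun j => hcm _, ?_⟩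
  intro g hg
  suffices h : ∀ ε > 0, ∃ L : List (ℕ × ℕ), Phi μ (fun z => dist (codeFun A y L z) (g z)) ≤ ε by
    intro ε hε
    obtain ⟨L, hL⟩ := h ε hε
    exact ⟨Encodable.encode L, by simpa using hL⟩
  intro ε hε
  classical
  -- hybrid functions
  let B : ℕ → Set X := fun j => {z | dist (y j) (g z) < ε / 3}
  have hBm : ∀ j, MeasurableSet (B j) := fun j =>
    measurableSet_lt (measurable_const.dist hg) measurable_const
  obtain ⟨hyb, hyb_zero, hyb_succ⟩ : ∃ hyb : ℕ → X → Y, (hyb 0 = fun _ => y 0) ∧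
      ∀ k, hyb (k + 1) = fun z => if z ∈ B k then y k else hyb k z :=
    ⟨fun k => Nat.rec (fun _ => y 0) (fun j f z => if z ∈ B j then y j else f z) k, rfl,
      fun k => rfl⟩
  have hhm : ∀ k, Measurable (hyb k) := by
    intro k
    induction k with
    | zero => rw [hyb_zero]; exact measurable_const
    | succ k ih => rw [hyb_succ]; exact Measurable.ite (hBm k) measurable_const ih
  have happ : ∀ k, ∀ ε > 0, ∃ L : List (ℕ × ℕ), Phi μ (fun z => dist (codeFun A y L z) (hyb k z)) ≤ ε := by
    intro k
    induction k with
    | zero =>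
      intro ε hε
      refine ⟨[], ?_⟩
      refine (Phi_le (C := 0) ⟨(hcm []).dist (hhm 0), fun z => ?_⟩).trans hε.le
      simp [codeFun, hyb_zero]
    | succ k ih =>
      intro ε hε
      obtain ⟨L, hL⟩ := ih (ε / 2) (half_pos hε)
      have hd : 0 < ε / 2 / (C + 1) := by positivity
      obtain ⟨S, hS, hSm, hSle⟩ := approx_set h1 hb (B k) (hBm k) _ hd
      rw [hA] at hS
      obtain ⟨i, rfl⟩ := hS
      refine ⟨(i, k) :: L, ?_⟩
      have hi := GB_ind (hSm.symmDiff (hBm k))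
      have h2 := Phi_const_mul (μ := μ) hi hC0
      have hCi : GB C (fun z => C * (symmDiff (A i) (B k)).indicator (fun _ => (1 : ℝ)) z) :=
        ⟨hi.1.const_mul C, fun z => ⟨mul_nonneg hC0 (hi.2 z).1,
          mul_le_of_le_one_right hC0 (hi.2 z).2⟩⟩
      refine (Phi_le_add (hGB (codeFun A y ((i, k) :: L)) (hyb (k + 1)) (hcm _) (hhm _)) hCi
        (hGB (codeFun A y L) (hyb k) (hcm L) (hhm k)) ?_).trans ?_
      · intro z
        rw [hyb_succ]
        simp only [codeFun]
        by_cases hz1 : z ∈ A i <;> by_cases hz2 : z ∈ B k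
        · simp [hz1, hz2, Set.indicator, Set.mem_symmDiff]
        · simp only [hz1, hz2, Set.indicator, Set.mem_symmDiff, if_true, if_false]
          simp only [not_false_eq_true, and_self, true_or, if_true, mul_one]
          exact (hC _ _).trans (le_add_of_nonneg_right dist_nonneg)
        · simp only [hz1, hz2, Set.indicator, Set.mem_symmDiff, if_true, if_false]
          simp only [not_false_eq_true, and_self, or_true, if_true, mul_one]
          exact (hC _ _).trans (le_add_of_nonneg_right dist_nonneg)
        · simp [hz1, hz2, Set.indicator, Set.mem_symmDiff]
      · have h3 : C * (ε / 2 / (C + 1)) ≤ ε / 2 := by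
          rw [mul_div_assoc', div_le_iff₀ (by positivity)]; nlinarith
        have h4 := mul_le_mul_of_nonneg_left hSle hC0
        linarith
  have hcov : ∀ k z, z ∉ (⋃ j < k, B j)ᶜ → dist (hyb k z) (g z) ≤ ε / 3 := by
    intro k z
    induction k with
    | zero => intro h; simp at h
    | succ k ih =>
      intro h
      rw [hyb_succ]
      beta_reduce
      split_ifs with hz
      · exact le_of_lt hz
      · apply ih
        rw [Set.biUnion_lt_succ] at h
        intro h'
        exact h fun h'' => h''.elim h' hz
  have hRm : ∀ k, MeasurableSet (⋃ j < k, B j)ᶜ := fun k =>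
    (MeasurableSet.iUnion fun i => MeasurableSet.iUnion fun _ => hBm i).compl
  have hd : 0 < ε / 3 / (C + 1) := by positivity
  obtain ⟨k, hk⟩ := h1.exists_le hRm (fun k l hkl => Set.compl_subset_compl.2
      (Set.biUnion_subset_biUnion_left fun i (hi : i < k) => lt_of_lt_of_le hi hkl)) (by
      ext z
      simp only [Set.mem_iInter, Set.mem_compl_iff, Set.mem_iUnion, Set.mem_empty_iff_false,
        iff_false]
      intro h
      obtain ⟨j, hj⟩ := (TopologicalSpace.denseRange_denseSeq Y).exists_dist_lt (g z)
        (show 0 < ε / 3 by positivity)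
      exact h (j + 1) ⟨j, by omega, by rw [dist_comm] at hj; exact hj⟩) hd
  obtain ⟨L, hL⟩ := happ k (ε / 3) (by positivity)
  refine ⟨L, ?_⟩
  have hi := GB_ind (hRm k)
  have h2 := Phi_const_mul (μ := μ) hi hC0
  have hCi : GB C (fun z => C * ((⋃ j < k, B j)ᶜ).indicator (fun _ => (1 : ℝ)) z) :=
    ⟨hi.1.const_mul C, fun z => ⟨mul_nonneg hC0 (hi.2 z).1,
      mul_le_of_le_one_right hC0 (hi.2 z).2⟩⟩
  have hcst : GB (X := X) (ε / 3) (fun _ => ε / 3) :=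
    ⟨measurable_const, fun z => ⟨by positivity, le_rfl⟩⟩
  have step1 := Phi_le_add (μ := μ) (hGB _ _ (hhm k) hg) hcst hCi (fun z => by
      by_cases hz : z ∈ (⋃ j < k, B j)ᶜ
      · rw [Set.indicator_of_mem hz, mul_one]
        exact (hC _ _).trans (le_add_of_nonneg_left (by positivity))
      · rw [Set.indicator_of_notMem hz, mul_zero, add_zero]
        exact hcov k z hz)
  have step2 := Phi_le_add (μ := μ) (hGB _ _ (hcm L) hg) (hGB _ _ (hcm L) (hhm k))
    (hGB _ _ (hhm k) hg) (fun z => dist_triangle _ _ _)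
  have h3 : C * (ε / 3 / (C + 1)) ≤ ε / 3 := by
    rw [mul_div_assoc', div_le_iff₀ (by positivity)]; nlinarith
  have h4 := mul_le_mul_of_nonneg_left hk hC0
  have h5 := Phi_le (μ := μ) hcst
  linarith

/-! ### Condition 1 implies SUIL -/

lemma exists_schedule {X Y : Type*} [MeasurableSpace X]
    [MetricSpace Y] [TopologicalSpace.SeparableSpace Y]
    [MeasurableSpace Y] [BorelSpace Y] {C : ℝ} (hC : ∀ y₁ y₂ : Y, dist y₁ y₂ ≤ C)
    (μ : Measure (ℕ → X)) [IsProbabilityMeasure μ] {F : ℕ → X → Y} (hF : ∀ j, Measurable (F j)) :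
    ∃ I : ℕ → ℕ, Tendsto I atTop atTop ∧ ∀ᵐ x ∂μ, ∀ᶠ n in atTop, ∀ j ≤ I n, ∀ k ≤ I n,
      Lav (fun t => dist (F j (x t)) (F k (x t))) - (1 / 2) ^ (I n) ≤
        Wm (fun t => dist (F j (x t)) (F k (x t))) (I n) n := by
  have : SecondCountableTopology Y := UniformSpace.secondCountable_of_separable Y
  have hm : ∀ j k t, Measurable fun x : ℕ → X => dist (F j (x t)) (F k (x t)) := fun j k t =>
    ((hF j).comp (measurable_pi_apply t)).dist ((hF k).comp (measurable_pi_apply t))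
  let E : ℕ → ℕ → Set (ℕ → X) := fun i n => {x | ∀ j ≤ i, ∀ k ≤ i,
      Lav (fun t => dist (F j (x t)) (F k (x t))) - (1 / 2) ^ i ≤
        Wm (fun t => dist (F j (x t)) (F k (x t))) i n}
  have hEm : ∀ i n, MeasurableSet (E i n) := by
    intro i n
    simp only [E, Set.ofPred_forall]
    refine MeasurableSet.iInter fun j => MeasurableSet.iInter fun _ =>
      MeasurableSet.iInter fun k => MeasurableSet.iInter fun _ => ?_
    exact measurableSet_le ((measurable_Lav (hm j k)).sub_const _) (measurable_Wm (hm j k) i n)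
  have hEmono : ∀ i, Monotone (E i) := fun i n n' h x hx j hj k hk =>
    (hx j hj k hk).trans (Wm_mono _ i h)
  have hEuniv : ∀ i x, ∃ n, x ∈ E i n := by
    intro i x
    have h1 : ∀ j k, ∃ n, Lav (fun t => dist (F j (x t)) (F k (x t))) - (1 / 2) ^ i ≤
        Wm (fun t => dist (F j (x t)) (F k (x t))) i n := fun j k =>
      Wm_ge (C := C) (fun t => ⟨dist_nonneg, hC _ _⟩) i (by positivity)
    choose N hN using h1
    refine ⟨(Finset.range (i + 1)).sup fun j => (Finset.range (i + 1)).sup fun k => N j k, ?_⟩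
    intro j hj k hk
    refine (hN j k).trans (Wm_mono _ i ?_)
    refine le_trans ?_ (Finset.le_sup (f := fun j => (Finset.range (i + 1)).sup fun k => N j k)
      (Finset.mem_range.2 (Nat.lt_succ_of_le hj)))
    exact Finset.le_sup (f := fun k => N j k) (Finset.mem_range.2 (Nat.lt_succ_of_le hk))
  have hex : ∀ i : ℕ, ∃ n, μ (E i n)ᶜ ≤ (1 / 2 : ENNReal) ^ i := by
    intro i
    have h1 := tendsto_measure_iInter_atTop (μ := μ) (s := fun n => (E i n)ᶜ)
      (fun n => (hEm i n).compl.nullMeasurableSet)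
      (fun n n' h => Set.compl_subset_compl.2 (hEmono i h)) ⟨0, measure_ne_top _ _⟩
    have h2 : ⋂ n, (E i n)ᶜ = ∅ := by
      ext x
      simp only [Set.mem_iInter, Set.mem_compl_iff, Set.mem_empty_iff_false, iff_false, not_forall,
        not_not]
      exact hEuniv i x
    rw [h2, measure_empty] at h1
    have h3 : (0 : ENNReal) < (1 / 2 : ENNReal) ^ i := by
      apply ENNReal.pow_pos; simp
    exact (h1.eventually (ge_mem_nhds h3)).exists
  choose N hN using hex
  refine ⟨fun n => Nat.findGreatest (fun i => N i ≤ n) n, ?_, ?_⟩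
  · refine tendsto_atTop.2 fun i => ?_
    filter_upwards [eventually_ge_atTop i, eventually_ge_atTop (N i)] with n h1 h2
    exact Nat.le_findGreatest h1 h2
  · have hsum : ∑' i, μ (E i (N i))ᶜ ≠ ⊤ := by
      refine ne_top_of_le_ne_top ?_ (ENNReal.tsum_le_tsum hN)
      rw [ENNReal.tsum_geometric]
      simp
    filter_upwards [ae_eventually_notMem hsum] with x hx
    obtain ⟨i0, hi0⟩ := eventually_atTop.1 hx
    filter_upwards [eventually_ge_atTop i0, eventually_ge_atTop (N i0)] with n h1 h2
    have h3 : i0 ≤ Nat.findGreatest (fun i => N i ≤ n) n := Nat.le_findGreatest h1 h2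
    have h4 : N (Nat.findGreatest (fun i => N i ≤ n) n) ≤ n :=
      Nat.findGreatest_spec (P := fun i => N i ≤ n) h1 h2
    have h5 := hi0 _ h3
    simp only [Set.mem_compl_iff, not_not] at h5
    exact hEmono _ h4 h5

/-- loss of hypothesis `j` on the data, extended by zero -/
noncomputable def dataLoss {X Y : Type*} [PseudoMetricSpace Y] (F : ℕ → X → Y) (n : ℕ)
    (x : Fin n → X) (y : Fin n → Y) (j : ℕ) (t : ℕ) : ℝ :=
  if h : t < n then dist (F j (x ⟨t, h⟩)) (y ⟨t, h⟩) else 0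

lemma exists_argmin (s : ℕ → ℝ) (i : ℕ) : ∃ j, j ≤ i ∧ ∀ k ≤ i, s j ≤ s k := by
  obtain ⟨j, hj, h⟩ := Finset.exists_min_image (Finset.range (i + 1)) s
    Finset.nonempty_range_add_one
  exact ⟨j, Nat.lt_succ_iff.1 (Finset.mem_range.1 hj),
    fun k hk => h k (Finset.mem_range.2 (Nat.lt_succ_of_le hk))⟩

open Classical in
noncomputable def argmin (s : ℕ → ℝ) (i : ℕ) : ℕ := Nat.find (exists_argmin s i)

lemma argmin_spec (s : ℕ → ℝ) (i : ℕ) : argmin s i ≤ i ∧ ∀ k ≤ i, s (argmin s i) ≤ s k := by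
  classical
  exact Nat.find_spec (exists_argmin s i)

lemma measurable_argmin {Ω : Type*} [MeasurableSpace Ω] {s : Ω → ℕ → ℝ}
    (h : ∀ j, Measurable fun w => s w j) (i : ℕ) : Measurable fun w => argmin (s w) i := by
  classical
  unfold argmin
  refine measurable_find (fun w => exists_argmin (s w) i) fun j => ?_
  simp only [Set.ofPred_and, Set.ofPred_forall]
  exact MeasurableSet.inter (MeasurableSet.const _) (MeasurableSet.iInter fun k =>
    MeasurableSet.iInter fun _ => measurableSet_le (h j) (h k))

lemma condition1_SUIL {X Y : Type*} [MeasurableSpace X]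
    [MeasurableSpace.CountablyGenerated X]
    [MetricSpace Y] [TopologicalSpace.SeparableSpace Y] [Nonempty Y]
    [MeasurableSpace Y] [BorelSpace Y] {C : ℝ} (hC : ∀ y₁ y₂ : Y, dist y₁ y₂ ≤ C)
    {μ : Measure (ℕ → X)} [IsProbabilityMeasure μ] (h1 : Condition1 μ) : SUIL Y μ := by
  have : SecondCountableTopology Y := UniformSpace.secondCountable_of_separable Y
  obtain ⟨F, hF, hdense⟩ := exists_dense_family hC h1
  obtain ⟨I, hI, hsched⟩ := exists_schedule hC μ hF
  let sel : ∀ n : ℕ, (Fin n → X) → (Fin n → Y) → ℕ := fun n x y =>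
    argmin (fun j => Wm (dataLoss F n x y j) (I n) n) (I n)
  refine ⟨fun n x y z => F (sel n x y) z, ?_, ?_⟩
  · intro n
    have hsel : Measurable fun p : (Fin n → X) × (Fin n → Y) × X => sel n p.1 p.2.1 := by
      refine measurable_argmin (fun j => measurable_Wm (fun t => ?_) _ _) _
      unfold dataLoss
      split_ifs with h
      · exact ((hF j).comp ((measurable_pi_apply _).comp measurable_fst)).dist
          ((measurable_pi_apply _).comp (measurable_fst.comp measurable_snd))
      · exact measurable_const
    have hFF : Measurable fun q : X × ℕ => F q.2 q.1 :=
      measurable_from_prod_countable_left fun j => hF j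
    exact hFF.comp ((measurable_snd.comp measurable_snd).prodMk hsel)
  · intro g hg
    have hB : ∀ (f g : X → Y) (x : ℕ → X), InB C (fun t => dist (f (x t)) (g (x t))) :=
      fun f g x t => ⟨dist_nonneg, hC _ _⟩
    have hGB : ∀ j, GB C (fun z => dist (F j z) (g z)) :=
      fun j => ⟨(hF j).dist hg, fun z => ⟨dist_nonneg, hC _ _⟩⟩
    -- almost surely some hypothesis is arbitrarily good
    have hgood : ∀ᵐ x ∂μ, ∀ q : ℕ, ∃ j,
        Lav (fun t => dist (F j (x t)) (g (x t))) ≤ 1 / ((q : ℝ) + 1) := by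
      rw [ae_all_iff]
      intro q
      have hδ : (0 : ℝ) < 1 / ((q : ℝ) + 1) := by positivity
      set δ := 1 / ((q : ℝ) + 1)
      have hbd : ∀ η > 0, μ.real {x | ∀ j, δ < Lav (fun t => dist (F j (x t)) (g (x t)))} ≤ η := by
        intro η hη
        obtain ⟨j, hj⟩ := hdense g hg (δ * η) (by positivity)
        have hmk := mul_meas_ge_le_integral_of_nonneg (μ := μ)
          (Eventually.of_forall fun x => Lav_nonneg ((hGB j).inB x)) ((hGB j).int) δ
        have h3 : δ * μ.real {x | δ ≤ Lav (fun t => dist (F j (x t)) (g (x t)))} ≤ δ * η :=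
          hmk.trans hj
        refine le_trans (measureReal_mono fun x hx => ?_) (le_of_mul_le_mul_left h3 hδ)
        exact (hx j).le
      have h0 : μ {x | ∀ j, δ < Lav (fun t => dist (F j (x t)) (g (x t)))} = 0 := by
        have := le_of_forall_pos_le_add (a := μ.real _) (b := 0)
          (fun η hη => by rw [zero_add]; exact hbd η hη)
        exact (measureReal_eq_zero_iff).1 (le_antisymm this measureReal_nonneg)
      rw [ae_iff]
      convert h0 using 2
      ext x
      simp
    filter_upwards [hsched, hgood] with x hx1 hx2
    have hloss : ∀ n, indLoss (fun n x y z => F (sel n x y) z) g n x =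
        Lav (fun t => dist (F (sel n (fun i => x i.1) (fun i => g (x i.1))) (x t)) (g (x t))) :=
      fun n => Lav_shift (hB (F (sel n (fun i => x i.1) (fun i => g (x i.1)))) g x) n
    simp only [hloss]
    rw [Metric.tendsto_atTop']
    suffices h : ∀ ε > 0, ∀ᶠ n in atTop, Lav (fun t =>
        dist (F (sel n (fun i => x i.1) (fun i => g (x i.1))) (x t)) (g (x t))) ≤ 6 * ε by
      intro ε hε
      obtain ⟨N, hN⟩ := eventually_atTop.1 (h (ε / 7) (by positivity))
      refine ⟨N, fun n hn => ?_⟩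
      rw [Real.dist_eq, sub_zero, abs_of_nonneg (Lav_nonneg (hB _ _ x))]
      have := hN n hn.le
      linarith
    intro ε hε
    obtain ⟨q, hq⟩ := exists_nat_one_div_lt hε
    obtain ⟨k, hk⟩ := hx2 q
    have hk' := hk.trans hq.le
    obtain ⟨M, hM⟩ := eventually_atTop.1 (ev_le_limsup (av_le (hB (F k) g x)) hε)
    have hpow : ∀ᶠ n in atTop, ((1 : ℝ) / 2) ^ (I n) ≤ ε :=
      (((tendsto_pow_atTop_nhds_zero_of_lt_one (by norm_num) (by norm_num)).comp hI).eventually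
        (ge_mem_nhds hε))
    filter_upwards [hx1, hpow, hI.eventually (eventually_ge_atTop k),
      hI.eventually (eventually_ge_atTop M)] with n e1 e2 e3 e4
    obtain ⟨s1, s2⟩ := argmin_spec
      (fun j => Wm (dataLoss F n (fun i => x i.1) (fun i => g (x i.1)) j) (I n) n) (I n)
    have hcongr : ∀ j, Wm (dataLoss F n (fun i => x i.1) (fun i => g (x i.1)) j) (I n) n
        = Wm (fun t => dist (F j (x t)) (g (x t))) (I n) n := fun j =>
      Wm_congr fun t ht => by simp [dataLoss, ht]
    change sel n (fun i => x i.1) (fun i => g (x i.1)) ≤ I n at s1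
    have s3 := s2 k e3
    change Wm (dataLoss F n (fun i => x i.1) (fun i => g (x i.1))
      (sel n (fun i => x i.1) (fun i => g (x i.1)))) (I n) n ≤ _ at s3
    simp only [hcongr] at s3
    set J := sel n (fun i => x i.1) (fun i => g (x i.1))
    have w1 : Wm (fun t => dist (F k (x t)) (g (x t))) (I n) n ≤ 2 * ε := by
      refine Wm_le (by positivity) fun m hm => ?_
      have := hM m (e4.trans hm)
      change _ ≤ Lav _ + ε at this
      linarith
    have w2 := Wm_le_add (a := fun t => dist (F J (x t)) (F k (x t)))
      (b := fun t => dist (F J (x t)) (g (x t))) (c := fun t => dist (F k (x t)) (g (x t)))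
      (fun t => dist_triangle_right _ _ _) (I n) n
    have w3 := e1 J s1 k e3
    have w4 := Lav_le_add (hB (F J) g x) (hB (F J) (F k) x) (hB (F k) g x)
      (fun t => dist_triangle _ _ _)
    linarith

/-! ### SUIL implies SUAL -/

lemma SUIL_SUAL {X Y : Type*} [MeasurableSpace X] [MeasurableSpace Y] [MetricSpace Y]
    [Nonempty Y] {μ : Measure (ℕ → X)} (h : SUIL Y μ) : SUAL Y μ := by
  obtain ⟨f, hf, hc⟩ := h
  let y0 : Y := Classical.arbitrary Y
  refine ⟨fun n m x y z => if h : n ≤ m then f n (fun i => x (Fin.castLE h i)) y z else y0, ?_, ?_⟩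
  · intro n m hnm
    simp only [hnm, dif_pos]
    have h1 : Measurable fun p : (Fin m → X) × (Fin n → Y) × X =>
        ((fun i => p.1 (Fin.castLE hnm i) : Fin n → X), p.2.1, p.2.2) := by fun_prop
    exact (hf n).comp h1
  · intro g hg
    filter_upwards [hc g hg] with x hx
    convert hx using 2 with n
    unfold adaLoss indLoss
    have := limsup_nat_add (fun t : ℕ =>
      (∑ s ∈ Finset.range t,
          dist (f n (fun i => x i.1) (fun i => g (x i.1)) (x (n + s)))
            (g (x (n + s)))) / (t : ℝ)) 1
    rw [← this]
    congr 1
    funext t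
    simp

/-! ### SUAL implies Condition 1 -/

noncomputable def coin : Measure Bool :=
  (2⁻¹ : ENNReal) • (Measure.dirac true + Measure.dirac false)

instance : IsProbabilityMeasure coin := by
  constructor
  simp [coin]
  exact ENNReal.inv_two_add_inv_two

lemma coin_map_not : coin.map not = coin := by
  have hm : Measurable not := measurable_of_countable _
  unfold coin
  rw [Measure.map_smul, Measure.map_add _ _ hm, Measure.map_dirac' hm, Measure.map_dirac' hm]
  simp [add_comm]

noncomputable def coins : Measure (ℕ → Bool) := Measure.infinitePi fun _ : ℕ => coin

instance : IsProbabilityMeasure coins := by unfold coins; infer_instance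

/-- flip all coordinates beyond `k` -/
def flipAbove (k : ℕ) (K : ℕ → Bool) : ℕ → Bool := fun i => if k < i then !(K i) else K i

lemma mp_flip (k : ℕ) : MeasurePreserving (flipAbove k) coins coins := by
  have hm : ∀ i, Measurable (fun b : Bool => if k < i then !b else b) := fun i =>
    measurable_of_countable _
  have e : flipAbove k = fun (K : ℕ → Bool) i => (fun b : Bool => if k < i then !b else b) (K i) :=
    rfl
  refine ⟨?_, ?_⟩
  · rw [e]
    exact measurable_pi_lambda _ fun i => (hm i).comp (measurable_pi_apply i)
  · rw [e]
    unfold coins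
    rw [Measure.infinitePi_map_pi (μ := fun _ : ℕ => coin) (f := fun i b => if k < i then !b else b)
      hm]
    congr 1
    funext i
    split_ifs
    · exact coin_map_not
    · exact Measure.map_id

section Lower

set_option linter.unusedSectionVars false

variable {X Y : Type*} [MeasurableSpace X] [MetricSpace Y]

open Classical in
noncomputable def lev (A : ℕ → Set X) (he : ∀ z, ∃ k, z ∉ A k) (z : X) : ℕ := Nat.find (he z)

lemma lev_le {A : ℕ → Set X} (he : ∀ z, ∃ k, z ∉ A k) {z : X} {k : ℕ} (h : z ∉ A k) :
    lev A he z ≤ k := by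
  classical
  exact Nat.find_min' (he z) h

lemma lt_lev {A : ℕ → Set X} (ha : Antitone A) (he : ∀ z, ∃ k, z ∉ A k) {z : X} {k : ℕ}
    (h : z ∈ A k) : k < lev A he z := by
  classical
  by_contra h'
  exact Nat.find_spec (he z) (ha (not_lt.1 h') h)

lemma measurable_lev {A : ℕ → Set X} (hA : ∀ k, MeasurableSet (A k)) (he : ∀ z, ∃ k, z ∉ A k) :
    Measurable (lev A he) := by
  classical
  exact measurable_find he fun k => (hA k).compl

/-- random target -/
def tgt (N : X → ℕ) (y₀ y₁ : Y) (K : ℕ → Bool) (z : X) : Y := bif K (N z) then y₁ else y₀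

/-- loss of the self-adaptive rule on the random target -/
noncomputable def rloss (f : ∀ n m : ℕ, (Fin m → X) → (Fin n → Y) → X → Y) (N : X → ℕ)
    (y₀ y₁ : Y) (n : ℕ) (K : ℕ → Bool) (x : ℕ → X) (s : ℕ) : ℝ :=
  dist (f n (n + s) (fun i => x i.1) (fun i => tgt N y₀ y₁ K (x i.1)) (x (n + s)))
    (tgt N y₀ y₁ K (x (n + s)))

lemma adaLoss_eq (f : ∀ n m : ℕ, (Fin m → X) → (Fin n → Y) → X → Y) (N : X → ℕ)
    (y₀ y₁ : Y) (n : ℕ) (K : ℕ → Bool) (x : ℕ → X) :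
    adaLoss f (tgt N y₀ y₁ K) n x = Lav (rloss f N y₀ y₁ n K x) := by
  unfold adaLoss Lav
  rw [← limsup_nat_add (av _) 1]
  congr 1
  funext t
  simp [av, rloss]

variable [TopologicalSpace.SeparableSpace Y] [MeasurableSpace Y] [BorelSpace Y]

lemma measurable_tgt {N : X → ℕ} (hN : Measurable N) (y₀ y₁ : Y) :
    Measurable fun p : (ℕ → Bool) × X => tgt N y₀ y₁ p.1 p.2 := by
  have h1 : Measurable fun q : (ℕ → Bool) × ℕ => q.1 q.2 :=
    measurable_from_prod_countable_left fun j => measurable_pi_apply j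
  have h2 : Measurable fun p : (ℕ → Bool) × X => p.1 (N p.2) :=
    h1.comp (measurable_fst.prodMk (hN.comp measurable_snd))
  exact (measurable_of_countable fun b : Bool => bif b then y₁ else y₀).comp h2

lemma measurable_rloss {f : ∀ n m : ℕ, (Fin m → X) → (Fin n → Y) → X → Y}
    (hf : IsSelfAdaptiveRule f) {N : X → ℕ} (hN : Measurable N) (y₀ y₁ : Y) (n s : ℕ) :
    Measurable fun p : (ℕ → Bool) × (ℕ → X) => rloss f N y₀ y₁ n p.1 p.2 s := by
  have : SecondCountableTopology Y := UniformSpace.secondCountable_of_separable Y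
  have ht : ∀ i : ℕ, Measurable fun p : (ℕ → Bool) × (ℕ → X) => tgt N y₀ y₁ p.1 (p.2 i) :=
    fun i => (measurable_tgt hN y₀ y₁).comp
      (measurable_fst.prodMk ((measurable_pi_apply i).comp measurable_snd))
  have hx : ∀ i : ℕ, Measurable fun p : (ℕ → Bool) × (ℕ → X) => p.2 i :=
    fun i => (measurable_pi_apply i).comp measurable_snd
  unfold rloss
  refine Measurable.dist ?_ (ht _)
  exact (hf n (n + s) (by omega)).comp ((measurable_pi_lambda _ fun i : Fin (n + s) => hx i.1).prodMk
    ((measurable_pi_lambda _ fun i : Fin n => ht i.1).prodMk (hx (n + s))))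

lemma lower_bound {C : ℝ} (hC : ∀ y₁ y₂ : Y, dist y₁ y₂ ≤ C)
    {f : ∀ n m : ℕ, (Fin m → X) → (Fin n → Y) → X → Y} (hf : IsSelfAdaptiveRule f)
    {A : ℕ → Set X} (hA : ∀ k, MeasurableSet (A k)) (ha : Antitone A)
    (he : ∀ z, ∃ k, z ∉ A k) (y₀ y₁ : Y) (n : ℕ) (x : ℕ → X) :
    dist y₀ y₁ / 2 * (⨅ k, muHatSet x (A k)) ≤
      ∫ K, Lav (rloss f (lev A he) y₀ y₁ n K x) ∂coins := by
  set N := lev A he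
  have hN : Measurable N := measurable_lev hA he
  have hB : ∀ K, InB C (rloss f N y₀ y₁ n K x) := fun K s => ⟨dist_nonneg, hC _ _⟩
  have hmK : ∀ s, Measurable fun K => rloss f N y₀ y₁ n K x s := fun s =>
    (measurable_rloss hf hN y₀ y₁ n s).comp (measurable_id.prodMk measurable_const)
  have hint : ∀ s, Integrable (fun K => rloss f N y₀ y₁ n K x s) coins := fun s =>
    Integrable.of_bound (hmK s).aestronglyMeasurable C (Eventually.of_forall fun K => by
      rw [Real.norm_eq_abs, abs_of_nonneg (hB K s).1]; exact (hB K s).2)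
  obtain ⟨k, hk⟩ : ∃ k, ∀ t < n, x t ∉ A k := by
    choose kk hkk using fun t => he (x t)
    refine ⟨(Finset.range n).sup kk, fun t ht h => hkk t (ha ?_ h)⟩
    exact Finset.le_sup (f := kk) (Finset.mem_range.2 ht)
  have hIB : ∀ k, InB 1 (fun t => (A k).indicator (fun _ => (1 : ℝ)) (x t)) :=
    fun k => (GB_ind (hA k)).inB x
  have hd : 0 ≤ dist y₀ y₁ / 2 := by positivity
  -- expected one-step loss
  have hone : ∀ s, dist y₀ y₁ / 2 * (A k).indicator (fun _ => (1 : ℝ)) (x (n + s)) ≤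
      ∫ K, rloss f N y₀ y₁ n K x s ∂coins := by
    intro s
    by_cases hz : x (n + s) ∈ A k
    swap
    · rw [Set.indicator_of_notMem hz, mul_zero]
      exact integral_nonneg fun K => (hB K s).1
    rw [Set.indicator_of_mem hz, mul_one]
    have hmp := mp_flip k
    have e1 : ∫ K, rloss f N y₀ y₁ n (flipAbove k K) x s ∂coins =
        ∫ K, rloss f N y₀ y₁ n K x s ∂coins := by
      conv_rhs => rw [← hmp.map_eq]
      rw [integral_map hmp.measurable.aemeasurable]
      exact (hmK s).aestronglyMeasurable
    have hint' : Integrable (fun K => rloss f N y₀ y₁ n (flipAbove k K) x s) coins :=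
      hmp.integrable_comp_of_integrable (hint s)
    have hpt : ∀ K, dist y₀ y₁ ≤ rloss f N y₀ y₁ n K x s +
        rloss f N y₀ y₁ n (flipAbove k K) x s := by
      intro K
      have hl : (fun i : Fin n => tgt N y₀ y₁ (flipAbove k K) (x i.1)) =
          fun i : Fin n => tgt N y₀ y₁ K (x i.1) := by
        funext i
        have : ¬ k < N (x i.1) := not_lt.2 (lev_le he (hk i.1 i.2))
        simp [tgt, flipAbove, this]
      have hlt : k < N (x (n + s)) := lt_lev ha he hz
      unfold rloss
      rw [hl]
      have h3 : dist y₀ y₁ = dist (tgt N y₀ y₁ K (x (n + s)))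
          (tgt N y₀ y₁ (flipAbove k K) (x (n + s))) := by
        simp only [tgt, flipAbove, hlt, if_true]
        cases K (N (x (n + s))) <;> simp [dist_comm]
      rw [h3]
      exact dist_triangle_left _ _ _
    have h4 : ∫ K, dist y₀ y₁ ∂coins ≤ ∫ K, (rloss f N y₀ y₁ n K x s +
        rloss f N y₀ y₁ n (flipAbove k K) x s) ∂coins :=
      integral_mono (integrable_const _) ((hint s).add hint') hpt
    rw [integral_add (hint s) hint', e1] at h4
    simp at h4
    linarith
  -- averages
  have hav : ∀ t, dist y₀ y₁ / 2 *
      av (fun s => (A k).indicator (fun _ => (1 : ℝ)) (x (n + s))) t ≤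
      ∫ K, av (rloss f N y₀ y₁ n K x) t ∂coins := by
    intro t
    unfold av
    rw [integral_div, integral_finsetSum _ fun s _ => hint s, mul_div_assoc', Finset.mul_sum]
    exact div_le_div_of_nonneg_right (Finset.sum_le_sum fun s _ => hone s) (Nat.cast_nonneg t)
  have hfat := limsup_integral_le_real coins (C := C)
    (u := fun t K => av (rloss f N y₀ y₁ n K x) t) (fun t => measurable_av hmK t)
    (fun t K => av_nonneg (hB K) t) (fun t K => av_le (hB K) t)
  refine le_trans ?_ hfat
  have hshift := Lav_shift (hIB k) n
  have hinf : (⨅ k, muHatSet x (A k)) ≤ Lav (fun t => (A k).indicator (fun _ => (1 : ℝ)) (x t)) :=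
    ciInf_le ⟨0, by rintro _ ⟨j, rfl⟩; exact Lav_nonneg (hIB j)⟩ k
  refine (mul_le_mul_of_nonneg_left hinf hd).trans ?_
  rw [← hshift]
  refine le_of_forall_pos_le_add fun ε hε => ?_
  have hIB' : InB 1 (fun s => (A k).indicator (fun _ => (1 : ℝ)) (x (n + s))) :=
    fun s => hIB k (n + s)
  rw [← sub_le_iff_le_add]
  refine limsup_ge_real (C := C) (fun t => ?_) ?_
  · calc ∫ K, av (rloss f N y₀ y₁ n K x) t ∂coins ≤ ∫ K, C ∂coins := by
          refine integral_mono ?_ (integrable_const _) fun K => av_le (hB K) t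
          exact Integrable.of_bound (measurable_av hmK t).aestronglyMeasurable C
            (Eventually.of_forall fun K => by
              rw [Real.norm_eq_abs, abs_of_nonneg (av_nonneg (hB K) t)]; exact av_le (hB K) t)
      _ = C := by simp
  · have hε' : 0 < ε / (dist y₀ y₁ / 2 + 1) := by positivity
    refine (freq_ge_limsup (av_nonneg hIB') hε').mono fun t ht => le_trans ?_ (hav t)
    have h5 := mul_le_mul_of_nonneg_left ht hd
    have h6 : dist y₀ y₁ / 2 * (ε / (dist y₀ y₁ / 2 + 1)) ≤ ε := by
      rw [mul_div_assoc', div_le_iff₀ (by positivity)]; nlinarith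
    unfold Lav
    linarith

lemma SUAL_condition1 {C : ℝ} (hC : ∀ y₁ y₂ : Y, dist y₁ y₂ ≤ C)
    (hnt : ∃ y₁ y₂ : Y, 0 < dist y₁ y₂)
    {μ : Measure (ℕ → X)} [IsProbabilityMeasure μ] (h : SUAL Y μ) : Condition1 μ := by
  obtain ⟨f, hf, hcons⟩ := h
  obtain ⟨y₀, y₁, hd⟩ := hnt
  intro A hA ha hinter
  have he : ∀ z, ∃ k, z ∉ A k := by
    intro z
    by_contra! hz
    have : z ∈ ⋂ k, A k := Set.mem_iInter.2 hz
    rw [hinter] at this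
    exact this
  have hN := measurable_lev hA he
  set N := lev A he with hNdef
  have hGB : ∀ k, GB 1 ((A k).indicator fun _ => (1 : ℝ)) := fun k => GB_ind (hA k)
  have hn0 : ∀ k x, 0 ≤ muHatSet x (A k) := fun k x => Lav_nonneg ((hGB k).inB x)
  have hn1 : ∀ k x, muHatSet x (A k) ≤ 1 := fun k x => Lav_le ((hGB k).inB x)
  have hmm : ∀ k, Measurable fun x : ℕ → X => muHatSet x (A k) := fun k => (hGB k).meas
  have hbd : ∀ x : ℕ → X, BddBelow (Set.range fun k => muHatSet x (A k)) := fun x =>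
    ⟨0, by rintro _ ⟨k, rfl⟩; exact hn0 k x⟩
  let c : (ℕ → X) → ℝ := fun x => ⨅ k, muHatSet x (A k)
  have hc0 : ∀ x, 0 ≤ c x := fun x => le_ciInf fun k => hn0 k x
  have hc1 : ∀ x, c x ≤ 1 := fun x => (ciInf_le (hbd x) 0).trans (hn1 0 x)
  have hcm : Measurable c := Measurable.iInf hmm
  have hcint : Integrable c μ :=
    Integrable.of_bound hcm.aestronglyMeasurable 1 (Eventually.of_forall fun x => by
      rw [Real.norm_eq_abs, abs_of_nonneg (hc0 x)]; exact hc1 x)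
  have hlim : Tendsto (fun k => ∫ x, muHatSet x (A k) ∂μ) atTop (𝓝 (∫ x, c x ∂μ)) := by
    refine tendsto_integral_of_dominated_convergence (fun _ => (1 : ℝ))
      (fun k => (hmm k).aestronglyMeasurable) (integrable_const _)
      (fun k => Eventually.of_forall fun x => by
        rw [Real.norm_eq_abs, abs_of_nonneg (hn0 k x)]; exact hn1 k x)
      (Eventually.of_forall fun x => ?_)
    refine tendsto_atTop_ciInf (fun k l hkl => ?_) (hbd x)
    refine Lav_mono ((hGB l).inB x) ((hGB k).inB x) fun t => ?_
    exact Set.indicator_le_indicator_of_subset (ha hkl) (fun _ => zero_le_one) (x t)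
  suffices hz : ∫ x, c x ∂μ = 0 by rwa [hz] at hlim
  -- the double integral
  have hBR : ∀ n K x, InB C (rloss f N y₀ y₁ n K x) := fun n K x s => ⟨dist_nonneg, hC _ _⟩
  obtain ⟨R, hR⟩ : ∃ R : ℕ → (ℕ → Bool) → (ℕ → X) → ℝ,
      ∀ n K x, R n K x = Lav (rloss f N y₀ y₁ n K x) := ⟨_, fun _ _ _ => rfl⟩
  have hR0 : ∀ n K x, 0 ≤ R n K x := fun n K x => by
    rw [hR]; exact Lav_nonneg (hBR n K x)
  have hRC : ∀ n K x, R n K x ≤ C := fun n K x => by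
    rw [hR]; exact Lav_le (hBR n K x)
  have hRabs : ∀ n K x, ‖R n K x‖ ≤ C := fun n K x => by
    rw [Real.norm_eq_abs, abs_of_nonneg (hR0 n K x)]; exact hRC n K x
  have hRm : ∀ n, Measurable fun p : (ℕ → Bool) × (ℕ → X) => R n p.1 p.2 := fun n => by
    simp only [hR]
    exact measurable_Lav fun s => measurable_rloss hf hN y₀ y₁ n s
  have hRmx : ∀ n K, Measurable (R n K) := fun n K =>
    (hRm n).comp (measurable_const.prodMk measurable_id)
  have hin : ∀ K, Tendsto (fun n => ∫ x, R n K x ∂μ) atTop (𝓝 0) := by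
    intro K
    have ht : Measurable (tgt N y₀ y₁ K) :=
      (measurable_tgt hN y₀ y₁).comp (measurable_const.prodMk measurable_id)
    have := tendsto_integral_of_dominated_convergence (μ := μ) (F := fun n x => R n K x)
      (f := fun _ => (0 : ℝ)) (fun _ => C)
      (fun n => (hRmx n K).aestronglyMeasurable) (integrable_const _)
      (fun n => Eventually.of_forall fun x => hRabs n K x)
      (by
        filter_upwards [hcons _ ht] with x hx
        simpa only [adaLoss_eq, ← hR] using hx)
    simpa using this
  have hout : Tendsto (fun n => ∫ K, ∫ x, R n K x ∂μ ∂coins) atTop (𝓝 0) := by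
    have := tendsto_integral_of_dominated_convergence (μ := coins)
      (F := fun n K => ∫ x, R n K x ∂μ) (f := fun _ => (0 : ℝ)) (fun _ => C)
      (fun n => ((hRm n).stronglyMeasurable.integral_prod_right).aestronglyMeasurable)
      (integrable_const _)
      (fun n => Eventually.of_forall fun K => by
        refine (norm_integral_le_of_norm_le_const (C := C)
          (Eventually.of_forall fun x => hRabs n K x)).trans ?_
        simp)
      (Eventually.of_forall hin)
    simpa using this
  have hlow : ∀ n, dist y₀ y₁ / 2 * ∫ x, c x ∂μ ≤ ∫ K, ∫ x, R n K x ∂μ ∂coins := by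
    intro n
    have hRint : Integrable (Function.uncurry (R n)) (coins.prod μ) :=
      Integrable.of_bound (hRm n).aestronglyMeasurable C
        (Eventually.of_forall fun p => hRabs n p.1 p.2)
    rw [integral_integral_swap hRint, ← integral_const_mul]
    refine integral_mono (hcint.const_mul _) hRint.integral_prod_right fun x => ?_
    have := lower_bound hC hf hA ha he y₀ y₁ n x
    simpa only [hR] using this
  have hle : dist y₀ y₁ / 2 * ∫ x, c x ∂μ ≤ 0 := ge_of_tendsto' hout hlow
  have hge : 0 ≤ ∫ x, c x ∂μ := integral_nonneg hc0
  nlinarith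

end Lower

/-- **Theorem 7 (Hanneke).** `SUIL = SUAL = C1`: a process satisfies Condition 1 iff it
admits strong universal inductive learning iff it admits strong universal self-adaptive
learning. -/
theorem condition1_iff_SUIL_iff_SUAL (X Y : Type*)
    [TopologicalSpace X] [TopologicalSpace.MetrizableSpace X]
    [TopologicalSpace.SeparableSpace X] [Nonempty X] [MeasurableSpace X] [BorelSpace X]
    [MetricSpace Y] [TopologicalSpace.SeparableSpace Y] [Nonempty Y]
    [MeasurableSpace Y] [BorelSpace Y]
    (hbdd : ∃ C : ℝ, ∀ y₁ y₂ : Y, dist y₁ y₂ ≤ C)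
    (hnontriv : ∃ y₁ y₂ : Y, 0 < dist y₁ y₂)
    (μ : Measure (ℕ → X)) (hμ : IsProbabilityMeasure μ) :
    (Condition1 μ ↔ SUIL Y μ) ∧ (SUIL Y μ ↔ SUAL Y μ) := by
  obtain ⟨C, hC⟩ := hbdd
  have : SecondCountableTopology X := by
    let _ := TopologicalSpace.metrizableSpaceMetric X
    exact UniformSpace.secondCountable_of_separable X
  have h12 : Condition1 μ → SUIL Y μ := fun h => condition1_SUIL hC h
  have h23 : SUIL Y μ → SUAL Y μ := SUIL_SUAL
  have h31 : SUAL Y μ → Condition1 μ := fun h => SUAL_condition1 hC hnontriv h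
  exact ⟨⟨h12, fun h => h31 (h23 h)⟩, ⟨h23, fun h => h12 (h31 h)⟩⟩
end

section
/- There exists a countable collection T1 ⊆ B of measurable sets such that for every process 𝕏 satisfying Condition 1 and every A ∈ B, inf_{G ∈ T1} E[μ̂_𝕏(G △ A)] = 0, where △ denotes symmetric difference. -/
open MeasureTheory Filter Topology

lemma aux_avg_nonneg {X : Type*} (x : ℕ → X) (A : Set X) (n : ℕ) :
    0 ≤ (∑ t ∈ Finset.range n, A.indicator (fun _ => (1 : ℝ)) (x t)) / (n : ℝ) :=
  div_nonneg (Finset.sum_nonneg fun t _ => Set.indicator_nonneg (fun _ _ => zero_le_one) _)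
    (Nat.cast_nonneg n)

lemma aux_avg_le_one {X : Type*} (x : ℕ → X) (A : Set X) (n : ℕ) :
    (∑ t ∈ Finset.range n, A.indicator (fun _ => (1 : ℝ)) (x t)) / (n : ℝ) ≤ 1 := by
  apply div_le_one_of_le₀ _ (Nat.cast_nonneg n)
  calc _ ≤ ∑ t ∈ Finset.range n, (1 : ℝ) :=
        Finset.sum_le_sum fun t _ => Set.indicator_le_self' (fun _ _ => zero_le_one) _
    _ = n := by simp

lemma aux_bdd {X : Type*} (x : ℕ → X) (A : Set X) :
    IsBoundedUnder (· ≤ ·) atTop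
      (fun n : ℕ => (∑ t ∈ Finset.range n, A.indicator (fun _ => (1 : ℝ)) (x t)) / (n : ℝ)) :=
  isBoundedUnder_of ⟨1, aux_avg_le_one x A⟩

lemma aux_bdd' {X : Type*} (x : ℕ → X) (A : Set X) :
    IsBoundedUnder (· ≥ ·) atTop
      (fun n : ℕ => (∑ t ∈ Finset.range n, A.indicator (fun _ => (1 : ℝ)) (x t)) / (n : ℝ)) :=
  isBoundedUnder_of ⟨0, aux_avg_nonneg x A⟩

lemma aux_nonneg {X : Type*} (x : ℕ → X) (A : Set X) : 0 ≤ muHatSet x A :=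
  le_limsup_of_frequently_le (Frequently.of_forall (aux_avg_nonneg x A)) (aux_bdd x A)

lemma aux_le_one {X : Type*} (x : ℕ → X) (A : Set X) : muHatSet x A ≤ 1 :=
  limsup_le_of_le (aux_bdd' x A).isCoboundedUnder_le (Eventually.of_forall (aux_avg_le_one x A))

lemma aux_sub {X : Type*} (x : ℕ → X) {A B C : Set X} (h : A ⊆ B ∪ C) :
    muHatSet x A ≤ muHatSet x B + muHatSet x C := by
  refine le_trans ?_ (limsup_add_le (aux_bdd' x B) (aux_bdd x B)
    (aux_bdd' x C).isCoboundedUnder_le (aux_bdd x C))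
  refine limsup_le_limsup (Eventually.of_forall fun n => ?_) (aux_bdd' x A).isCoboundedUnder_le
    (isBoundedUnder_le_add (aux_bdd x B) (aux_bdd x C))
  simp only [Pi.add_apply]
  rw [← add_div, ← Finset.sum_add_distrib]
  refine div_le_div_of_nonneg_right (Finset.sum_le_sum fun t _ => ?_) (Nat.cast_nonneg n)
  by_cases hA : x t ∈ A
  · rcases h hA with hB | hC
    · rw [Set.indicator_of_mem hA, Set.indicator_of_mem hB]
      linarith [Set.indicator_nonneg (s := C) (f := fun _ => (1 : ℝ))
        (fun _ _ => zero_le_one) (x t)]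
    · rw [Set.indicator_of_mem hA, Set.indicator_of_mem hC]
      linarith [Set.indicator_nonneg (s := B) (f := fun _ => (1 : ℝ))
        (fun _ _ => zero_le_one) (x t)]
  · rw [Set.indicator_of_notMem hA]
    exact add_nonneg (Set.indicator_nonneg (fun _ _ => zero_le_one) _)
      (Set.indicator_nonneg (fun _ _ => zero_le_one) _)

lemma aux_meas {X : Type*} [MeasurableSpace X] {A : Set X} (hA : MeasurableSet A) :
    Measurable (fun x : ℕ → X => muHatSet x A) := by
  unfold muHatSet muHat
  refine Measurable.limsup fun n => ?_
  refine Measurable.div_const (Finset.measurable_sum _ fun t _ => ?_) _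
  exact (measurable_const.indicator hA).comp (measurable_pi_apply t)

lemma aux_int {X : Type*} [MeasurableSpace X] (μ : Measure (ℕ → X)) [IsProbabilityMeasure μ]
    {A : Set X} (hA : MeasurableSet A) : Integrable (fun x : ℕ → X => muHatSet x A) μ := by
  refine Integrable.of_bound (aux_meas hA).aestronglyMeasurable 1 (Eventually.of_forall fun x => ?_)
  rw [Real.norm_eq_abs, abs_of_nonneg (aux_nonneg x A)]
  exact aux_le_one x A

lemma aux_int_sub {X : Type*} [MeasurableSpace X] (μ : Measure (ℕ → X)) [IsProbabilityMeasure μ]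
    {A B C : Set X} (hA : MeasurableSet A) (hB : MeasurableSet B) (hC : MeasurableSet C)
    (h : A ⊆ B ∪ C) :
    ∫ x, muHatSet x A ∂μ ≤ ∫ x, muHatSet x B ∂μ + ∫ x, muHatSet x C ∂μ := by
  rw [← integral_add (aux_int μ hB) (aux_int μ hC)]
  exact integral_mono (aux_int μ hA) ((aux_int μ hB).add (aux_int μ hC)) fun x => aux_sub x h

lemma aux_main {X : Type*} [m : MeasurableSpace X] (S T : Set (Set X)) (hS : S ⊆ T)
    (hm : m = MeasurableSpace.generateFrom S)
    (hT : IsSetAlgebra T) (hTm : ∀ G ∈ T, MeasurableSet G)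
    (μ : Measure (ℕ → X)) [IsProbabilityMeasure μ] (hμ : Condition1 μ)
    (A : Set X) (hA : MeasurableSet A) :
    ∀ ε > 0, ∃ G ∈ T, ∫ x, muHatSet x (symmDiff G A) ∂μ < ε := by
  have hempty : ∫ x, muHatSet x (∅ : Set X) ∂μ = 0 := by
    simp [muHatSet, muHat]
  refine MeasurableSpace.induction_on_inter (C := fun A _ => ∀ ε > 0, ∃ G ∈ T,
    ∫ x, muHatSet x (symmDiff G A) ∂μ < ε) (s := T) ?_ ?_ ?_ ?_ ?_ ?_ A hA
  · apply le_antisymm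
    · rw [hm]; exact MeasurableSpace.generateFrom_mono hS
    · exact MeasurableSpace.generateFrom_le hTm
  · intro a ha b hb _
    exact hT.inter_mem ha hb
  · intro ε hε
    exact ⟨∅, hT.empty_mem, by simpa [hempty] using hε⟩
  · intro t ht ε hε
    exact ⟨t, ht, by simpa [hempty] using hε⟩
  · intro t htm ih ε hε
    obtain ⟨G, hG, h⟩ := ih ε hε
    refine ⟨Gᶜ, hT.compl_mem hG, ?_⟩
    have : symmDiff Gᶜ tᶜ = symmDiff G t := by
      ext y; simp only [Set.mem_symmDiff, Set.mem_compl_iff]; tauto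
    rwa [this]
  · intro f _ hfm ih ε hε
    have hfin : ∀ n : ℕ, ∀ ε > 0, ∃ G ∈ T,
        ∫ x, muHatSet x (symmDiff G (⋃ i, ⋃ (_ : i < n), f i)) ∂μ < ε := by
      intro n
      induction n with
      | zero =>
        intro ε hε
        exact ⟨∅, hT.empty_mem, by simpa [hempty] using hε⟩
      | succ n ihn =>
        intro ε hε
        obtain ⟨G, hG, h⟩ := ihn (ε / 2) (by linarith)
        obtain ⟨G', hG', h'⟩ := ih n (ε / 2) (by linarith)
        refine ⟨G ∪ G', hT.union_mem hG hG', ?_⟩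
        have hU : ∀ n : ℕ, MeasurableSet (⋃ i, ⋃ (_ : i < n), f i) := fun n =>
          MeasurableSet.iUnion fun i => MeasurableSet.iUnion fun _ => hfm i
        have := aux_int_sub μ (((hTm G hG).union (hTm G' hG')).symmDiff (hU (n + 1)))
          ((hTm G hG).symmDiff (hU n)) ((hTm G' hG').symmDiff (hfm n)) (by
            rw [Set.biUnion_lt_succ]
            intro y
            simp only [Set.mem_symmDiff, Set.mem_union]
            tauto)
        linarith
    have hU : ∀ n : ℕ, MeasurableSet (⋃ i, ⋃ (_ : i < n), f i) := fun n =>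
      MeasurableSet.iUnion fun i => MeasurableSet.iUnion fun _ => hfm i
    have hUU : MeasurableSet (⋃ i, f i) := MeasurableSet.iUnion hfm
    have hlim := hμ (fun n => (⋃ i, f i) \ (⋃ i, ⋃ (_ : i < n), f i))
      (fun n => hUU.diff (hU n))
      (fun a b hab => Set.diff_subset_diff_right
        (Set.iUnion_mono fun i => Set.iUnion_mono' fun hi => ⟨hi.trans_le hab, le_rfl⟩))
      (by
        rw [Set.eq_empty_iff_forall_notMem]
        intro y hy
        rw [Set.mem_iInter] at hy
        obtain ⟨i, hi⟩ := Set.mem_iUnion.1 (hy 0).1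
        exact (hy (i + 1)).2 (Set.mem_iUnion₂.2 ⟨i, Nat.lt_succ_self i, hi⟩))
    obtain ⟨n, hn⟩ := (hlim.eventually (gt_mem_nhds (half_pos hε))).exists
    obtain ⟨G, hG, h⟩ := hfin n (ε / 2) (half_pos hε)
    refine ⟨G, hG, ?_⟩
    have hsub : (⋃ i, ⋃ (_ : i < n), f i) ⊆ ⋃ i, f i :=
      Set.iUnion_mono fun i => Set.iUnion_subset fun _ => le_rfl
    have := aux_int_sub μ ((hTm G hG).symmDiff hUU) ((hTm G hG).symmDiff (hU n))
      (hUU.diff (hU n)) (by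
        intro y
        have := @hsub y
        simp only [Set.mem_symmDiff, Set.mem_union, Set.mem_diff]
        tauto)
    linarith

/-- **Lemma 16 (Hanneke).** There is a countable collection `T1` of measurable sets such
that for every process satisfying Condition 1 and every measurable `A`,
`inf_{G ∈ T1} E[μ̂_𝕏(G △ A)] = 0`. -/
theorem exists_countable_approximating_sets (X : Type*)
    [TopologicalSpace X] [TopologicalSpace.MetrizableSpace X]
    [TopologicalSpace.SeparableSpace X] [Nonempty X] [MeasurableSpace X] [BorelSpace X] :
    ∃ T1 : Set (Set X), T1.Countable ∧ (∀ G ∈ T1, MeasurableSet G) ∧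
      ∀ μ : Measure (ℕ → X), IsProbabilityMeasure μ → Condition1 μ →
        ∀ A : Set X, MeasurableSet A →
          IsGLB ((fun G => ∫ x, muHatSet x (symmDiff G A) ∂μ) '' T1) 0 := by
  letI := TopologicalSpace.metrizableSpaceMetric X
  haveI : SecondCountableTopology X := UniformSpace.secondCountable_of_separable X
  obtain ⟨b, hbc, -, hb⟩ := TopologicalSpace.exists_countable_basis X
  have hm : (inferInstance : MeasurableSpace X) = MeasurableSpace.generateFrom b := by
    rw [← hb.borel_eq_generateFrom]; exact BorelSpace.measurable_eq
  have hTm : ∀ G ∈ generateSetAlgebra b, MeasurableSet G := by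
    intro G hG
    have hm2 := hm.trans generateFrom_generateSetAlgebra_eq.symm
    simp only [inferInstance] at hm2
    rw [hm2]
    exact MeasurableSpace.measurableSet_generateFrom hG
  refine ⟨generateSetAlgebra b, countable_generateSetAlgebra hbc, hTm, ?_⟩
  intro μ hμ hc A hA
  constructor
  · rintro _ ⟨G, -, rfl⟩
    exact integral_nonneg fun x => aux_nonneg x _
  · intro r hr
    refine le_of_forall_pos_le_add fun ε hε => ?_
    obtain ⟨G, hG, h⟩ := aux_main b _ self_subset_generateSetAlgebra hm
      isSetAlgebra_generateSetAlgebra hTm μ hc A hA ε hε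
    have := hr ⟨G, hG, rfl⟩
    simp only at this
    linarith
end
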